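/- Let m ≥ 1 and let P₀, P₁, …, P_m be complex N×N Hermitian matrices such that P_k² = I for every k and P_j P_k = −P_k P_j for all j ≠ k. Let c = (c₀, …, c_m) be a nonzero real vector, D := Σ_{k=0}^m c_k P_k, and let ψ ∈ ℂ^N be a nonzero vector with P₀ ψ = −ψ. Then there exist complex numbers d₀, d₁, …, d_m such that the vector φ := d₀·ψ + Σ_{k=1}^m d_k·(P_k P₀) ψ is nonzero and satisfies D φ = −‖c‖₂ · φ. In particular, the eigenvalue −‖c‖₂ of D possesses an eigenvector lying in the span of the m + 1 vectors ψ, (P₁P₀)ψ, …, (P_mP₀)ψ. -/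

import Mathlib

open Matrix BigOperators

/-- The square of a linear combination of pairwise anticommuting involutions is a scalar. -/
theorem sum_smul_mul_self_of_anticommute {R A ι : Type*} [Field R] [CharZero R] [Ring A]
    [Algebra R A] [Fintype ι] (P : ι → A) (hsq : ∀ k, P k * P k = 1)
    (hanti : ∀ j k, j ≠ k → P j * P k = -(P k * P j)) (c : ι → R) :
    (∑ k, c k • P k) * (∑ k, c k • P k) = (∑ k, c k ^ 2) • (1 : A) := by
  classical
  have hexp : (∑ k, c k • P k) * (∑ k, c k • P k) = ∑ j, ∑ k, (c j * c k) • (P j * P k) := by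
    simp only [Finset.sum_mul_sum, smul_mul_smul_comm]
  have hadd : (2 : R) • ((∑ k, c k • P k) * (∑ k, c k • P k)) =
      (2 : R) • ((∑ k, c k ^ 2) • (1 : A)) := by
    rw [two_smul]
    nth_rewrite 2 [hexp.trans Finset.sum_comm]
    rw [hexp, ← Finset.sum_add_distrib, Finset.sum_smul, Finset.smul_sum]
    refine Finset.sum_congr rfl fun j _ => ?_
    rw [← Finset.sum_add_distrib, Finset.sum_eq_single j]
    · rw [hsq, two_smul, sq]
    · intro k _ hk
      rw [hanti k j hk, mul_comm (c k), smul_neg, add_neg_cancel]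
    · simp
  exact smul_right_injective A (two_ne_zero (α := R)) hadd

/-- Computational core of the stabilizer-rank theorem: for pairwise anticommuting
Hermitian involutions `P₀, …, P_m` (`m ≥ 1`), a nonzero real coefficient vector `c`,
`D = ∑ c k • P k`, and a nonzero vector `ψ` with `P₀ ψ = -ψ`, there are complex
coefficients `d k` such that `φ = d₀ • ψ + ∑_{k=1}^m d k • (P k P₀) ψ` is a nonzero
eigenvector of `D` with eigenvalue `-‖c‖₂`; in particular the eigenvalue `-‖c‖₂` has an
eigenvector in the span of the `m + 1` vectors `ψ, (P₁P₀)ψ, …, (P_mP₀)ψ`. -/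
theorem eigenvector_in_span_of_stabilizer_images {N m : ℕ} (hm : 1 ≤ m)
    (P : Fin (m + 1) → Matrix (Fin N) (Fin N) ℂ)
    (hherm : ∀ k, (P k).IsHermitian)
    (hsq : ∀ k, P k * P k = 1)
    (hanti : ∀ j k, j ≠ k → P j * P k = -(P k * P j))
    (c : Fin (m + 1) → ℝ) (hc : c ≠ 0)
    (ψ : Fin N → ℂ) (hψ : ψ ≠ 0)
    (hP0ψ : (P 0).mulVec ψ = -ψ) :
    ∃ d : Fin (m + 1) → ℂ,
      d 0 • ψ + ∑ k : Fin m, d k.succ • (P k.succ * P 0).mulVec ψ ≠ 0 ∧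
      (∑ k, (c k : ℂ) • P k).mulVec
          (d 0 • ψ + ∑ k : Fin m, d k.succ • (P k.succ * P 0).mulVec ψ)
        = (-(Real.sqrt (∑ k, (c k) ^ 2)) : ℂ) •
            (d 0 • ψ + ∑ k : Fin m, d k.succ • (P k.succ * P 0).mulVec ψ) := by
  set r : ℝ := Real.sqrt (∑ k, (c k) ^ 2)
  have hr2 : r ^ 2 = ∑ k, (c k) ^ 2 :=
    Real.sq_sqrt (Finset.sum_nonneg fun k _ => sq_nonneg _)
  have hPψ : ∀ k, (P k).mulVec ψ = -(P k * P 0).mulVec ψ := fun k => by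
    rw [← Matrix.mulVec_mulVec, hP0ψ, Matrix.mulVec_neg, neg_neg]
  have hconj : ∀ k : Fin m,
      (P 0).mulVec ((P k.succ * P 0).mulVec ψ) = (P k.succ * P 0).mulVec ψ := fun k => by
    rw [Matrix.mulVec_mulVec, ← mul_assoc, hanti 0 k.succ (Fin.succ_ne_zero k).symm, neg_mul,
      mul_assoc, hsq, mul_one, Matrix.neg_mulVec, hPψ, neg_neg]
  by_cases h0 : r + c 0 = 0
  · have hc0 : ∀ k : Fin m, c k.succ = 0 := by
      have hs : ∑ k : Fin m, c k.succ ^ 2 = 0 := by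
        rw [Fin.sum_univ_succ] at hr2
        have : r = -c 0 := by linarith
        rw [this] at hr2
        linarith
      intro k
      have := (Finset.sum_eq_zero_iff_of_nonneg fun i _ => sq_nonneg _).1 hs k (Finset.mem_univ k)
      exact pow_eq_zero_iff two_ne_zero |>.1 this
    let i : Fin m := ⟨0, hm⟩
    have hφ : (Pi.single i.succ (1 : ℂ) : Fin (m + 1) → ℂ) 0 • ψ +
        ∑ k : Fin m, (Pi.single i.succ (1 : ℂ) : Fin (m + 1) → ℂ) k.succ •
          (P k.succ * P 0).mulVec ψ = (P i.succ * P 0).mulVec ψ := by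
      rw [Finset.sum_eq_single i]
      · simp [(Fin.succ_ne_zero i).symm]
      · intro k _ hk
        simp [hk]
      · simp
    refine ⟨Pi.single i.succ 1, ?_, ?_⟩
    · rw [hφ]
      intro h
      apply hψ
      rw [← Matrix.one_mulVec ψ, ← hsq i.succ, ← Matrix.mulVec_mulVec, hPψ, h]
      simp
    · have hD : ∑ k, (c k : ℂ) • P k = (c 0 : ℂ) • P 0 := by
        simp [Fin.sum_univ_succ, hc0]
      have hcr : (c 0 : ℂ) = -(r : ℂ) := by
        rw [← Complex.ofReal_neg]
        congr 1
        linarith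
      rw [hφ, hD, Matrix.smul_mulVec, hconj, hcr]
  · have hφ : ((r : ℂ) + c 0) • ψ + ∑ k : Fin m, (c k.succ : ℂ) • (P k.succ * P 0).mulVec ψ =
        (r : ℂ) • ψ - (∑ k, (c k : ℂ) • P k).mulVec ψ := by
      rw [Matrix.sum_mulVec, Fin.sum_univ_succ]
      simp only [Matrix.smul_mulVec, hP0ψ, hPψ (Fin.succ _), smul_neg, Finset.sum_neg_distrib]
      module
    refine ⟨Fin.cons ((r : ℂ) + c 0) fun k => (c k.succ : ℂ), ?_, ?_⟩
    · simp only [Fin.cons_zero, Fin.cons_succ]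
      intro h
      have hP := congrArg (P 0).mulVec h
      simp only [Matrix.mulVec_add, Matrix.mulVec_sum, Matrix.mulVec_smul, hP0ψ, hconj,
        Matrix.mulVec_zero] at hP
      have h2 : (2 * ((r : ℂ) + c 0)) • ψ = 0 := by
        rw [← sub_self (0 : Fin N → ℂ)]
        nth_rewrite 1 [← h]
        rw [← hP]
        module
      rcases smul_eq_zero.1 h2 with h3 | h3
      · apply h0
        exact_mod_cast (mul_eq_zero.1 h3).resolve_left two_ne_zero
      · exact hψ h3
    · simp only [Fin.cons_zero, Fin.cons_succ]
      have hr2' : ∑ k, (c k : ℂ) ^ 2 = (r : ℂ) ^ 2 := by exact_mod_cast hr2.symm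
      rw [hφ, Matrix.mulVec_sub, Matrix.mulVec_smul, Matrix.mulVec_mulVec,
        sum_smul_mul_self_of_anticommute P hsq hanti, hr2', Matrix.smul_mulVec,
        Matrix.one_mulVec]
      module
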